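/- Let Z be a nonempty finite set, π a prior on Z, R a finite set of possible outputs, and T ≥ 1. For t = 1,…,T let a_t : Z → ℝ satisfy 0 ≤ a_t z ≤ 1 for all z (a_t z represents Pr(x_t, ξ | z, S_{t−1}), the probability of the t-th input followed by the separator ξ), let R_t ⊆ R be the set of correct outputs for the t-th input, and let β_t : R → Z → ℝ satisfy β_t r z ≥ 0 for all r, z and Σ_{r∈R_t} β_t r z ≤ 1 (β_t r z represents Pr(r, d | x_t, ξ, z, S_{t−1})). Set b_t z := Σ_{r∈R_t} β_t r z. Fix z* ∈ Z with π z* > 0, a_t z* > 0 and b_t z* > 0 for all t. With M_t := Σ_{z∈Z} π z ∏_{i=1}^{t} a_i z · b_i z (M_0 = 1) and N_t := Σ_{z∈Z} π z (∏_{i=1}^{t−1} a_i z · b_i z) · a_t z, one has −(1/T) Σ_{t=1}^{T} log( M_t / N_t ) ≤ −(1/T) log(π z*) − (1/T) Σ_{t=1}^{T} log( b_t z* ) − (1/T) Σ_{t=1}^{T} log( a_t z* · M_{t−1} / N_t ). -/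

import Mathlib

theorem sum_Icc_one_sub_pred (f : ℕ → ℝ) (n : ℕ) :
    ∑ t ∈ Finset.Icc 1 n, (f t - f (t - 1)) = f n - f 0 := by
  induction n with
  | zero => simp
  | succ k ih =>
    rw [Finset.sum_Icc_succ_top (by omega), ih, Nat.add_sub_cancel]
    ring

/-- The appendix theorem "Average ICL Loss for Generation" of the Pelican Soup
paper.  For a generation task, `Rt t` is the finite set of correct outputs
for the `t`-th input, `a t z` represents `Pr(x_t, ξ | z, S_{t-1})` (input
followed by the separator `ξ`), `β t r z` represents
`Pr(r, d | x_t, ξ, z, S_{t-1})`, and `b t z = ∑_{r ∈ Rt t} β t r z`; the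
average cross-entropy loss `-(1/T) ∑ log (M t / N t)` of predicting an
acceptable output is bounded by the three terms on the right. -/
theorem pelican_soup_average_icl_loss_generation
    {Z R : Type*} [Fintype Z] [Nonempty Z] [Fintype R]
    (π : Z → ℝ) (hπ0 : ∀ z, 0 ≤ π z) (hπ1 : ∑ z, π z = 1)
    (T : ℕ) (hT : 1 ≤ T)
    (a : ℕ → Z → ℝ)
    (ha0 : ∀ t ∈ Finset.Icc 1 T, ∀ z, 0 ≤ a t z)
    (ha1 : ∀ t ∈ Finset.Icc 1 T, ∀ z, a t z ≤ 1)
    (Rt : ℕ → Finset R)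
    (β : ℕ → R → Z → ℝ)
    (hβ0 : ∀ t ∈ Finset.Icc 1 T, ∀ r z, 0 ≤ β t r z)
    (hβ1 : ∀ t ∈ Finset.Icc 1 T, ∀ z, ∑ r ∈ Rt t, β t r z ≤ 1)
    (b : ℕ → Z → ℝ)
    (hb : ∀ t z, b t z = ∑ r ∈ Rt t, β t r z)
    (zstar : Z) (hπz : 0 < π zstar)
    (haz : ∀ t ∈ Finset.Icc 1 T, 0 < a t zstar)
    (hbz : ∀ t ∈ Finset.Icc 1 T, 0 < b t zstar)
    (M N : ℕ → ℝ)
    (hM : ∀ t, M t = ∑ z, π z * ∏ i ∈ Finset.Icc 1 t, (a i z * b i z))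
    (hN : ∀ t, N t = ∑ z, π z * (∏ i ∈ Finset.Icc 1 (t - 1), (a i z * b i z)) * a t z) :
    -((1 / (T : ℝ)) * ∑ t ∈ Finset.Icc 1 T, Real.log (M t / N t)) ≤
      -((1 / (T : ℝ)) * Real.log (π zstar))
        - (1 / (T : ℝ)) * ∑ t ∈ Finset.Icc 1 T, Real.log (b t zstar)
        - (1 / (T : ℝ)) * ∑ t ∈ Finset.Icc 1 T,
            Real.log (a t zstar * M (t - 1) / N t) := by
  have hab0 : ∀ t ∈ Finset.Icc 1 T, ∀ z, 0 ≤ a t z * b t z := fun t ht z =>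
    mul_nonneg (ha0 t ht z) (hb t z ▸ Finset.sum_nonneg fun r _ => hβ0 t ht r z)
  have hmem : ∀ {t i}, t ≤ T → i ∈ Finset.Icc 1 t → i ∈ Finset.Icc 1 T := by
    intro t i ht hi
    rw [Finset.mem_Icc] at hi ⊢
    omega
  have hprod0 : ∀ t ≤ T, ∀ z, 0 ≤ ∏ i ∈ Finset.Icc 1 t, (a i z * b i z) :=
    fun t ht z => Finset.prod_nonneg fun i hi => hab0 i (hmem ht hi) z
  have hprodz : ∀ t ≤ T, 0 < ∏ i ∈ Finset.Icc 1 t, (a i zstar * b i zstar) :=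
    fun t ht => Finset.prod_pos fun i hi =>
      mul_pos (haz i (hmem ht hi)) (hbz i (hmem ht hi))
  have hMge : ∀ t ≤ T, π zstar * ∏ i ∈ Finset.Icc 1 t, (a i zstar * b i zstar) ≤ M t := by
    intro t ht
    rw [hM]
    exact Finset.single_le_sum
      (f := fun z => π z * ∏ i ∈ Finset.Icc 1 t, (a i z * b i z))
      (fun z _ => mul_nonneg (hπ0 z) (hprod0 t ht z)) (Finset.mem_univ zstar)
  have hMpos : ∀ t ≤ T, 0 < M t := fun t ht =>
    (mul_pos hπz (hprodz t ht)).trans_le (hMge t ht)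
  have hNpos : ∀ t ∈ Finset.Icc 1 T, 0 < N t := by
    intro t ht
    have ht' : t - 1 ≤ T := (Nat.sub_le t 1).trans (Finset.mem_Icc.mp ht).2
    rw [hN]
    exact Finset.sum_pos'
      (fun z _ => mul_nonneg (mul_nonneg (hπ0 z) (hprod0 _ ht' z)) (ha0 t ht z))
      ⟨zstar, Finset.mem_univ _, mul_pos (mul_pos hπz (hprodz _ ht')) (haz t ht)⟩
  have hM0 : M 0 = 1 := by simp [hM, hπ1]
  have hlogM : Real.log (π zstar)
      + ∑ t ∈ Finset.Icc 1 T, (Real.log (a t zstar) + Real.log (b t zstar))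
        ≤ Real.log (M T) := by
    have h := Real.log_le_log (mul_pos hπz (hprodz T le_rfl)) (hMge T le_rfl)
    rw [Real.log_mul hπz.ne' (hprodz T le_rfl).ne', Real.log_prod
      fun i hi => (mul_pos (haz i hi) (hbz i hi)).ne'] at h
    rwa [← Finset.sum_congr rfl fun i hi => Real.log_mul (haz i hi).ne' (hbz i hi).ne']
  have hloss : ∑ t ∈ Finset.Icc 1 T, Real.log (M t / N t)
      = Real.log (M T) - ∑ t ∈ Finset.Icc 1 T, Real.log (a t zstar)
        + ∑ t ∈ Finset.Icc 1 T, Real.log (a t zstar * M (t - 1) / N t) := by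
    have htel := sum_Icc_one_sub_pred (fun t => Real.log (M t)) T
    simp only [hM0, Real.log_one, sub_zero] at htel
    rw [← htel, ← Finset.sum_sub_distrib, ← Finset.sum_add_distrib]
    refine Finset.sum_congr rfl fun t ht => ?_
    have htT := (Finset.mem_Icc.mp ht).2
    have hpred := hMpos (t - 1) ((Nat.sub_le t 1).trans htT)
    rw [Real.log_div (hMpos t htT).ne' (hNpos t ht).ne',
      Real.log_div (mul_pos (haz t ht) hpred).ne' (hNpos t ht).ne',
      Real.log_mul (haz t ht).ne' hpred.ne']
    ring
  rw [Finset.sum_add_distrib] at hlogM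
  have hsum : Real.log (π zstar) + ∑ t ∈ Finset.Icc 1 T, Real.log (b t zstar)
      + ∑ t ∈ Finset.Icc 1 T, Real.log (a t zstar * M (t - 1) / N t)
        ≤ ∑ t ∈ Finset.Icc 1 T, Real.log (M t / N t) := by
    linarith
  have hscaled := mul_le_mul_of_nonneg_left hsum (by positivity : (0 : ℝ) ≤ 1 / T)
  linarith
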